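/- Assume the flag condition and let 2 ≤ i ≤ c. Then, counting k-dimensions of degree-zero graded hom spaces, one has the identity _0hom_R(B_i, B_i) − _0hom_R(M_i, M_i) = _0hom_R(B_i, G_i) − _0hom_R(B_i, F). In particular, if _0hom_R(M_i, M_i) = 1 then _0hom_R(B_i, B_i) = 1 + _0hom_R(B_i, G_i) − _0hom_R(B_i, F). -/

import Mathlib

open MvPolynomial

noncomputable section

/-- The ideal of `m × m` minors of a matrix with entries in a commutative ring. -/
def minorsIdeal {S : Type} [CommRing S] {p q : ℕ} (m : ℕ)
    (A : Matrix (Fin p) (Fin q) S) : Ideal S :=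
  Ideal.span {x | ∃ (f : Fin m → Fin p) (g : Fin m → Fin q),
    StrictMono f ∧ StrictMono g ∧ x = ((A.submatrix f g).det)}

/-- The height (codimension) of an ideal: the infimum of the heights of the primes
containing it. -/
def idealHeight {S : Type} [CommRing S] (I : Ideal S) : ℕ∞ :=
  sInf {h | ∃ p : PrimeSpectrum S, I ≤ p.asIdeal ∧ h = Order.height p}

/-- A homogeneous matrix for the degree data `(b; a)`:  the `(i,j)` entry is homogeneous of
degree `a j - b i` (in particular it is zero whenever `a j < b i`). -/
def IsHomogMat {S : Type} [CommSemiring S] {n p q : ℕ} (b : Fin p → ℤ) (a : Fin q → ℤ)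
    (A : Matrix (Fin p) (Fin q) (MvPolynomial (Fin (n + 1)) S)) : Prop :=
  ∀ i j, (A i j).IsHomogeneous (a j - b i).toNat ∧ (a j - b i < 0 → A i j = 0)

/-- The submatrix consisting of the first `m` columns. -/
def firstCols {S : Type} {p q : ℕ} (A : Matrix (Fin p) (Fin q) S) (m : ℕ) (h : m ≤ q) :
    Matrix (Fin p) (Fin m) S :=
  A.submatrix id (Fin.castLE h)

end
/-- The polynomial ring `R = k[x₀,…,xₙ]`. -/
abbrev PolyR (k : Type) [Field k] (n : ℕ) := MvPolynomial (Fin (n + 1)) k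

noncomputable section

variable {k : Type} [Field k]

/-- The flag condition: for every `2 ≤ i ≤ c` the ideal of maximal minors of the matrix
`𝒜_i` of the first `t + i − 1` columns has codimension `i`. -/
def flagCond {n t c : ℕ} (hc : 2 ≤ c)
    (A : Matrix (Fin t) (Fin (t + c - 1)) (PolyR k n)) : Prop :=
  ∀ i : ℕ, 2 ≤ i → ∀ _h : i ≤ c,
    idealHeight (minorsIdeal t (firstCols A (t + i - 1) (by omega))) = (i : ℕ∞)

/-- The degree-`d` graded piece of the shifted free module `⊕ᵢ R(s i)`:
the `i`-th component lies in `R_{d + s i}`. -/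
def degPiece (n : ℕ) {m : ℕ} (s : Fin m → ℤ) (d : ℤ) :
    Submodule k (Fin m → PolyR k n) :=
  Submodule.pi Set.univ fun i =>
    if 0 ≤ d + s i then MvPolynomial.homogeneousSubmodule (Fin (n + 1)) k (d + s i).toNat
    else ⊥

/-- The degree-`d` graded piece of a quotient of the shifted free module `⊕ᵢ R(s i)`. -/
def qPiece (n : ℕ) {m : ℕ} (s : Fin m → ℤ)
    (N : Submodule (PolyR k n) (Fin m → PolyR k n)) (d : ℤ) :
    Submodule k ((Fin m → PolyR k n) ⧸ N) :=
  (degPiece n s d).map (N.mkQ.restrictScalars k)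

/-- The `k`-subspace of degree-preserving (degree-zero) graded homomorphisms between two
`R`-modules equipped with specified graded pieces. -/
def gradedHom₀ {R : Type} [CommRing R] [Algebra k R] {Q1 Q2 : Type}
    [AddCommGroup Q1] [Module R Q1] [AddCommGroup Q2] [Module R Q2]
    [Module k Q2] [SMulCommClass R k Q2]
    (p1 : ℤ → Set Q1) (p2 : ℤ → Submodule k Q2) :
    Submodule k (Q1 →ₗ[R] Q2) where
  carrier := {g | ∀ d, ∀ x ∈ p1 d, g x ∈ p2 d}
  add_mem' := fun hg hh d x hx => by
    simpa using add_mem (hg d x hx) (hh d x hx)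
  zero_mem' := fun d x hx => by simp
  smul_mem' := fun c g hg d x hx => by
    simpa using (p2 d).smul_mem c (hg d x hx)

/-- `_0hom`: the `k`-dimension of the space of degree-preserving graded homomorphisms
between two quotients of shifted free graded modules. -/
def zeroHomDim (n : ℕ) {m1 m2 : ℕ}
    (s1 : Fin m1 → ℤ) (N1 : Submodule (PolyR k n) (Fin m1 → PolyR k n))
    (s2 : Fin m2 → ℤ) (N2 : Submodule (PolyR k n) (Fin m2 → PolyR k n)) : ℕ :=
  Module.finrank k
    (gradedHom₀ (R := PolyR k n)
      (Q1 := (Fin m1 → PolyR k n) ⧸ N1) (Q2 := (Fin m2 → PolyR k n) ⧸ N2)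
      (fun d => (qPiece n s1 N1 d : Set _)) (fun d => qPiece n s2 N2 d))

/-- The binomial coefficient `C(x, n)` for `x : ℤ`, with the convention that it vanishes
for `x < n`. -/
def intBinom (x : ℤ) (n : ℕ) : ℤ :=
  if x < (n : ℤ) then 0 else (x.toNat.choose n : ℤ)

end
open Matrix

noncomputable section

section Lifting

variable {k : Type} [Field k] {n : ℕ}

/-- The homogeneous polynomials of integral degree `e` (zero if `e < 0`). -/
abbrev intHomog (k : Type) [Field k] (n : ℕ) (e : ℤ) : Submodule k (PolyR k n) :=
  weightedHomogeneousSubmodule k (fun _ => (1 : ℤ)) e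

theorem mem_intHomog_iff {e : ℤ} {p : PolyR k n} :
    p ∈ intHomog k n e ↔ ∀ d, p.coeff d ≠ 0 → (d.degree : ℤ) = e := by
  have h (d : Fin (n + 1) →₀ ℕ) :
      Finsupp.weight (fun _ => (1 : ℤ)) d = (d.degree : ℤ) := by
    simp [Finsupp.weight_apply, Finsupp.degree_apply, Finsupp.sum]
  simp only [mem_weightedHomogeneousSubmodule, IsWeightedHomogeneous, h]

theorem intHomog_eq (e : ℤ) :
    intHomog k n e = if 0 ≤ e then homogeneousSubmodule (Fin (n + 1)) k e.toNat else ⊥ := by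
  ext p
  rw [mem_intHomog_iff]
  split_ifs with he
  · rw [mem_homogeneousSubmodule]
    constructor
    · intro h d hd
      have := h d hd
      rw [Finsupp.degree_eq_weight_one] at this
      have h' : Finsupp.weight 1 d = e.toNat := by
        simp only [Pi.one_def] at this ⊢
        omega
      exact h'
    · intro h d hd
      have := h hd
      rw [Finsupp.degree_eq_weight_one]
      simp only [Pi.one_def] at this ⊢
      omega
  · rw [Submodule.mem_bot]
    constructor
    · intro h
      ext d
      by_contra hd
      have := h d hd
      omega
    · rintro rfl
      simp

instance finite_intHomog (e : ℤ) : Module.Finite k (intHomog k n e) := by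
  refine Submodule.finiteDimensional_of_le
    (S₂ := restrictTotalDegree (Fin (n + 1)) k e.toNat) fun p hp => ?_
  rw [mem_restrictTotalDegree]
  refine Finset.sup_le fun d hd => ?_
  have := mem_intHomog_iff.1 hp d (by simpa using hd)
  rw [Finsupp.degree_apply] at this
  change ∑ i ∈ d.support, d i ≤ e.toNat
  omega

theorem mul_mem_intHomog {e f g : ℤ} (h : e + f = g) {p q : PolyR k n}
    (hp : p ∈ intHomog k n e) (hq : q ∈ intHomog k n f) : p * q ∈ intHomog k n g :=
  h ▸ IsWeightedHomogeneous.mul hp hq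

theorem mem_degPiece {m : ℕ} {s : Fin m → ℤ} {d : ℤ} {v : Fin m → PolyR k n} :
    v ∈ degPiece n s d ↔ ∀ j, v j ∈ intHomog k n (d + s j) := by
  simp [degPiece, intHomog_eq, Submodule.mem_pi]

theorem weightedHomogeneousComponent_mul_of_mem {e f : ℤ} {p : PolyR k n}
    (hp : p ∈ intHomog k n e) (q : PolyR k n) :
    weightedHomogeneousComponent (fun _ => (1 : ℤ)) (e + f) (p * q) =
      p * weightedHomogeneousComponent (fun _ => (1 : ℤ)) f q := by
  let := weightedGradedAlgebra k (σ := Fin (n + 1)) (fun _ => (1 : ℤ))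
  have := DirectSum.coe_decompose_mul_add_of_left_mem (j := f) (b := q) (intHomog k n) hp
  exact (decompose'_apply k _ (p * q) (e + f)).symm.trans
    (this.trans (congrArg (p * ·) (decompose'_apply k _ q f)))

/-- The matrices representing degree-preserving maps `⊕ R(s₁ i) → ⊕ R(s₂ j)`. -/
def homogMat (k : Type) [Field k] (n : ℕ) {m₁ m₂ : ℕ} (s₁ : Fin m₁ → ℤ) (s₂ : Fin m₂ → ℤ) :
    Submodule k (Matrix (Fin m₂) (Fin m₁) (PolyR k n)) where
  carrier := {X | ∀ j i, X j i ∈ intHomog k n (s₂ j - s₁ i)}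
  add_mem' hX hY j i := add_mem (hX j i) (hY j i)
  zero_mem' _ _ := zero_mem _
  smul_mem' r _ hX j i := Submodule.smul_mem _ r (hX j i)

variable {m₁ m₂ m₃ : ℕ} {s₁ : Fin m₁ → ℤ} {s₂ : Fin m₂ → ℤ} {s₃ : Fin m₃ → ℤ}

theorem mem_homogMat {X : Matrix (Fin m₂) (Fin m₁) (PolyR k n)} :
    X ∈ homogMat k n s₁ s₂ ↔ ∀ j i, X j i ∈ intHomog k n (s₂ j - s₁ i) := Iff.rfl

instance finite_homogMat : Module.Finite k (homogMat k n s₁ s₂) := by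
  let f : homogMat k n s₁ s₂ →ₗ[k] ∀ j i, intHomog k n (s₂ j - s₁ i) :=
    { toFun := fun X j i => ⟨X.1 j i, X.2 j i⟩
      map_add' := fun _ _ => rfl
      map_smul' := fun _ _ => rfl }
  refine Module.Finite.of_injective f fun X Y h => ?_
  ext1
  ext1 j i
  exact congrArg Subtype.val (congrFun (congrFun h j) i)

theorem mul_mem_homogMat {X : Matrix (Fin m₃) (Fin m₂) (PolyR k n)}
    {Y : Matrix (Fin m₂) (Fin m₁) (PolyR k n)} (hX : X ∈ homogMat k n s₂ s₃)
    (hY : Y ∈ homogMat k n s₁ s₂) : X * Y ∈ homogMat k n s₁ s₃ := fun _ _ =>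
  Submodule.sum_mem _ fun _ _ => mul_mem_intHomog (by ring) (hX _ _) (hY _ _)

theorem transpose_mem_homogMat {X : Matrix (Fin m₂) (Fin m₁) (PolyR k n)} :
    X.transpose ∈ homogMat k n (-s₂) (-s₁) ↔ X ∈ homogMat k n s₁ s₂ := by
  simp only [mem_homogMat, transpose_apply, Pi.neg_apply, neg_sub_neg]
  exact forall_comm

theorem mulVec_mem_degPiece {X : Matrix (Fin m₂) (Fin m₁) (PolyR k n)}
    (hX : X ∈ homogMat k n s₁ s₂) {d : ℤ} {v : Fin m₁ → PolyR k n}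
    (hv : v ∈ degPiece n s₁ d) : X *ᵥ v ∈ degPiece n s₂ d :=
  mem_degPiece.2 fun _ => Submodule.sum_mem _ fun _ _ =>
    mul_mem_intHomog (by ring) (hX _ _) (mem_degPiece.1 hv _)

/-- A homogeneous matrix whose image lies in the image of a homogeneous matrix `C` factors
homogeneously through `C`. -/
theorem exists_eq_mul_of_mulVec_mem_range {C : Matrix (Fin m₃) (Fin m₂) (PolyR k n)}
    (hC : C ∈ homogMat k n s₂ s₃) {X : Matrix (Fin m₃) (Fin m₁) (PolyR k n)}
    (hX : X ∈ homogMat k n s₁ s₃) (h : ∀ v, X *ᵥ v ∈ LinearMap.range C.mulVecLin) :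
    ∃ Y ∈ homogMat k n s₁ s₂, X = C * Y := by
  choose y hy using fun i => h (Pi.single i 1)
  refine ⟨Matrix.of fun j i =>
      weightedHomogeneousComponent (fun _ => (1 : ℤ)) (s₂ j - s₁ i) (y i j),
    fun j i => weightedHomogeneousComponent_mem _ _ _, ?_⟩
  ext1 l i
  have hl : X l i = ∑ j, C l j * y i j := by
    have := congrFun (hy i) l
    simp only [mulVec_single_one] at this
    exact this.symm
  rw [mul_apply, ← (hX l i).weightedHomogeneousComponent_same, hl, map_sum]
  refine Finset.sum_congr rfl fun j _ => ?_
  rw [show s₃ l - s₁ i = (s₃ l - s₂ j) + (s₂ j - s₁ i) by ring]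
  exact weightedHomogeneousComponent_mul_of_mem (hC l j) (y i j)

/-- The homogeneous matrices that map `N₁` into `N₂`. -/
def liftSpace (s₁ : Fin m₁ → ℤ) (N₁ : Submodule (PolyR k n) (Fin m₁ → PolyR k n))
    (s₂ : Fin m₂ → ℤ) (N₂ : Submodule (PolyR k n) (Fin m₂ → PolyR k n)) :
    Submodule k (Matrix (Fin m₂) (Fin m₁) (PolyR k n)) where
  carrier := {X | X ∈ homogMat k n s₁ s₂ ∧ ∀ v ∈ N₁, X *ᵥ v ∈ N₂}
  add_mem' hX hY := ⟨add_mem hX.1 hY.1, fun v hv => by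
    rw [add_mulVec]; exact add_mem (hX.2 v hv) (hY.2 v hv)⟩
  zero_mem' := ⟨zero_mem _, fun v _ => by simp⟩
  smul_mem' r X hX := ⟨Submodule.smul_mem _ r hX.1, fun v hv => by
    rw [smul_mulVec]; exact Submodule.smul_of_tower_mem N₂ r (hX.2 v hv)⟩

variable {N₁ : Submodule (PolyR k n) (Fin m₁ → PolyR k n)}
  {N₂ : Submodule (PolyR k n) (Fin m₂ → PolyR k n)}

theorem mem_liftSpace {X : Matrix (Fin m₂) (Fin m₁) (PolyR k n)} :
    X ∈ liftSpace s₁ N₁ s₂ N₂ ↔ X ∈ homogMat k n s₁ s₂ ∧ ∀ v ∈ N₁, X *ᵥ v ∈ N₂ := Iff.rfl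

theorem liftSpace_le : liftSpace s₁ N₁ s₂ N₂ ≤ homogMat k n s₁ s₂ := fun _ h => h.1

instance finite_liftSpace : Module.Finite k (liftSpace s₁ N₁ s₂ N₂) :=
  Submodule.finiteDimensional_of_le liftSpace_le

theorem liftSpace_top_bot : liftSpace (k := k) (n := n) s₁ ⊤ s₂ ⊥ = ⊥ := by
  refine eq_bot_iff.2 fun X hX => ?_
  rw [Submodule.mem_bot]
  ext1 j i
  have := congrFun ((Submodule.mem_bot _).1 (hX.2 (Pi.single i 1) trivial)) j
  simpa using this

/-- The degree-preserving homomorphisms between quotients of shifted free modules. -/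
abbrev quotientHom₀ (s₁ : Fin m₁ → ℤ) (N₁ : Submodule (PolyR k n) (Fin m₁ → PolyR k n))
    (s₂ : Fin m₂ → ℤ) (N₂ : Submodule (PolyR k n) (Fin m₂ → PolyR k n)) :=
  gradedHom₀ (R := PolyR k n)
    (Q1 := (Fin m₁ → PolyR k n) ⧸ N₁) (Q2 := (Fin m₂ → PolyR k n) ⧸ N₂)
    (fun d => (qPiece n s₁ N₁ d : Set _)) (fun d => qPiece n s₂ N₂ d)

/-- The graded homomorphism of quotients induced by a homogeneous matrix. -/
def inducedHom (s₁ : Fin m₁ → ℤ) (N₁ : Submodule (PolyR k n) (Fin m₁ → PolyR k n))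
    (s₂ : Fin m₂ → ℤ) (N₂ : Submodule (PolyR k n) (Fin m₂ → PolyR k n)) :
    liftSpace s₁ N₁ s₂ N₂ →ₗ[k] quotientHom₀ s₁ N₁ s₂ N₂ where
  toFun X := ⟨N₁.mapQ N₂ X.1.mulVecLin X.2.2, by
    rintro d _ ⟨v, hv, rfl⟩
    exact ⟨X.1 *ᵥ v, mulVec_mem_degPiece X.2.1 hv, rfl⟩⟩
  map_add' X Y := by
    ext1
    refine Submodule.linearMap_qext _ (LinearMap.ext fun v => ?_)
    exact congrArg (Submodule.Quotient.mk (p := N₂)) (add_mulVec X.1 Y.1 v)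
  map_smul' r X := by
    ext1
    refine Submodule.linearMap_qext _ (LinearMap.ext fun v => ?_)
    exact congrArg (Submodule.Quotient.mk (p := N₂)) (smul_mulVec r X.1 v)

theorem inducedHom_surjective : Function.Surjective (inducedHom s₁ N₁ s₂ N₂) := by
  rintro ⟨g, hg⟩
  have hsingle (i : Fin m₁) :
      (Pi.single i 1 : Fin m₁ → PolyR k n) ∈ degPiece n s₁ (-s₁ i) := by
    refine mem_degPiece.2 fun j => ?_
    by_cases hj : j = i
    · subst hj
      simpa using isWeightedHomogeneous_one k (fun _ : Fin (n + 1) => (1 : ℤ))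
    · simp [hj]
  choose y hy hgy using fun i => hg (-s₁ i) (N₁.mkQ (Pi.single i 1)) ⟨_, hsingle i, rfl⟩
  let X : Matrix (Fin m₂) (Fin m₁) (PolyR k n) := fun j i => y i j
  have hXg : N₂.mkQ ∘ₗ X.mulVecLin = g ∘ₗ N₁.mkQ := by
    refine LinearMap.pi_ext' fun i => LinearMap.ext_ring ?_
    have : X *ᵥ Pi.single i 1 = y i := by
      rw [mulVec_single_one]; rfl
    simpa [this] using hgy i
  have hX : X ∈ liftSpace s₁ N₁ s₂ N₂ := by
    refine ⟨fun j i => ?_, fun v hv => ?_⟩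
    · have := mem_degPiece.1 (hy i) j
      rwa [neg_add_eq_sub] at this
    · have := LinearMap.congr_fun hXg v
      have h0 : N₁.mkQ v = 0 := by simpa using hv
      simp only [LinearMap.comp_apply, h0, map_zero] at this
      simpa using this
  refine ⟨⟨X, hX⟩, Subtype.ext (Submodule.linearMap_qext _ ?_)⟩
  rw [← hXg]
  rfl

theorem ker_inducedHom : LinearMap.ker (inducedHom s₁ N₁ s₂ N₂) =
    (liftSpace s₁ ⊤ s₂ N₂).comap (liftSpace s₁ N₁ s₂ N₂).subtype := by
  ext X
  rw [LinearMap.mem_ker, Submodule.mem_comap, Submodule.subtype_apply, mem_liftSpace]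
  constructor
  · intro h
    refine ⟨X.2.1, fun v _ => ?_⟩
    have := LinearMap.congr_fun (congrArg Subtype.val h) (N₁.mkQ v)
    exact (Submodule.Quotient.mk_eq_zero N₂).1 this
  · intro h
    refine Subtype.ext (Submodule.linearMap_qext _ (LinearMap.ext fun v => ?_))
    exact (Submodule.Quotient.mk_eq_zero N₂).2 (h.2 v trivial)

theorem liftSpace_top_le : liftSpace s₁ ⊤ s₂ N₂ ≤ liftSpace s₁ N₁ s₂ N₂ :=
  fun _ h => ⟨h.1, fun v _ => h.2 v trivial⟩

theorem zeroHomDim_add_finrank :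
    zeroHomDim n s₁ N₁ s₂ N₂ + Module.finrank k (liftSpace s₁ ⊤ s₂ N₂) =
      Module.finrank k (liftSpace s₁ N₁ s₂ N₂) := by
  have h := LinearMap.finrank_range_add_finrank_ker (K := k) (V := liftSpace s₁ N₁ s₂ N₂)
    (V₂ := quotientHom₀ s₁ N₁ s₂ N₂) (inducedHom s₁ N₁ s₂ N₂)
  rw [LinearMap.range_eq_top.2 inducedHom_surjective, finrank_top, ker_inducedHom,
    (Submodule.comapSubtypeEquivOfLe liftSpace_top_le).finrank_eq] at h
  exact h

theorem zeroHomDim_bot :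
    zeroHomDim n s₁ N₁ s₂ ⊥ = Module.finrank k (liftSpace s₁ N₁ s₂ ⊥) := by
  rw [← zeroHomDim_add_finrank, liftSpace_top_bot, finrank_bot, add_zero]

end Lifting

theorem finrank_map_add_finrank_inf_ker {K V W : Type*} [Field K] [AddCommGroup V] [Module K V]
    [AddCommGroup W] [Module K W] (f : V →ₗ[K] W) (S : Submodule K V) [Module.Finite K S] :
    Module.finrank K (S.map f) + Module.finrank K (S ⊓ LinearMap.ker f : Submodule K V) =
      Module.finrank K S := by
  rw [← (f.domRestrict S).finrank_range_add_finrank_ker, LinearMap.range_domRestrict,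
    LinearMap.ker_domRestrict, ← Submodule.map_comap_subtype,
    (Submodule.equivMapOfInjective _ S.injective_subtype _).finrank_eq]

section Cokernels

variable {k : Type} [Field k] {n p q : ℕ} {b : Fin p → ℤ} {a : Fin q → ℤ}
  {A : Matrix (Fin p) (Fin q) (PolyR k n)}

theorem IsHomogMat.transpose_mem (hA : IsHomogMat b a A) :
    A.transpose ∈ homogMat k n b a := by
  intro j i
  rw [intHomog_eq]
  split_ifs with h
  · exact (hA i j).1
  · exact (Submodule.mem_bot _).2 ((hA i j).2 (by omega))

theorem mulVec_transpose_injective_of_minorsIdeal_ne_bot {S : Type} [CommRing S] [IsDomain S]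
    {A : Matrix (Fin p) (Fin q) S} (h : minorsIdeal p A ≠ ⊥) :
    Function.Injective A.transpose.mulVec := by
  rw [minorsIdeal, Ne, Ideal.span_eq_bot] at h
  push Not at h
  obtain ⟨_, ⟨f, g, hf, -, rfl⟩, hdet⟩ := h
  have hf' : Function.Bijective f := Finite.injective_iff_bijective.1 hf.injective
  refine (injective_iff_map_eq_zero A.transpose.mulVecLin).2 fun v hv => ?_
  have hz : (A.submatrix f g).transpose *ᵥ (v ∘ f) = 0 := by
    ext l
    have := congrFun hv (g l)
    simp only [mulVecLin_apply, mulVec, dotProduct, transpose_apply, Pi.zero_apply] at this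
    simpa [mulVec, dotProduct] using
      (hf'.sum_comp fun i => A i (g l) * v i).trans this
  have := eq_zero_of_mulVec_eq_zero (by rwa [det_transpose]) hz
  ext i
  obtain ⟨j, rfl⟩ := hf'.2 i
  exact congrFun this j

theorem idealHeight_bot {S : Type} [CommRing S] [IsDomain S] :
    idealHeight (⊥ : Ideal S) = 0 :=
  le_antisymm (sInf_le ⟨⊥, bot_le, by simp⟩) bot_le

theorem exists_mul_eq_mul_of_mem_liftSpace {m₁ m₂ : ℕ} {s₁ : Fin m₁ → ℤ} {s₂ : Fin m₂ → ℤ}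
    {C : Matrix (Fin m₂) (Fin m₁) (PolyR k n)} (hC : C ∈ homogMat k n s₁ s₂)
    {X : Matrix (Fin m₂) (Fin m₂) (PolyR k n)}
    (hX : X ∈ liftSpace s₂ (LinearMap.range C.mulVecLin) s₂ (LinearMap.range C.mulVecLin)) :
    ∃ Y ∈ homogMat k n s₁ s₁, X * C = C * Y :=
  exists_eq_mul_of_mulVec_mem_range hC (mul_mem_homogMat hX.1 hC) fun v => by
    rw [← mulVec_mulVec]
    exact hX.2 _ ⟨v, rfl⟩

theorem mem_liftSpace_of_mul_eq {m₁ m₂ : ℕ} {s₂ : Fin m₂ → ℤ}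
    {C : Matrix (Fin m₂) (Fin m₁) (PolyR k n)}
    {X : Matrix (Fin m₂) (Fin m₂) (PolyR k n)} (hX : X ∈ homogMat k n s₂ s₂)
    {Y : Matrix (Fin m₁) (Fin m₁) (PolyR k n)} (h : X * C = C * Y) :
    X ∈ liftSpace s₂ (LinearMap.range C.mulVecLin) s₂ (LinearMap.range C.mulVecLin) := by
  refine ⟨hX, ?_⟩
  rintro _ ⟨v, rfl⟩
  refine ⟨Y *ᵥ v, ?_⟩
  simp only [mulVecLin_apply, mulVec_mulVec, h]

theorem mem_liftSpace_range_bot {m₁ m₂ m₃ : ℕ} {s₂ : Fin m₂ → ℤ}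
    {s₃ : Fin m₃ → ℤ} {C : Matrix (Fin m₂) (Fin m₁) (PolyR k n)}
    {X : Matrix (Fin m₃) (Fin m₂) (PolyR k n)} :
    X ∈ liftSpace s₂ (LinearMap.range C.mulVecLin) s₃ ⊥ ↔
      X ∈ homogMat k n s₂ s₃ ∧ X * C = 0 := by
  refine and_congr_right fun _ => ⟨fun h => mulVec_injective (funext fun v => ?_), ?_⟩
  · rw [← mulVec_mulVec, zero_mulVec]
    exact h _ ⟨v, rfl⟩
  · rintro h _ ⟨v, rfl⟩
    simp [mulVec_mulVec, h]

theorem map_mulLeft_homogMat {m₁ m₂ m₃ : ℕ} {s₁ : Fin m₁ → ℤ} {s₂ : Fin m₂ → ℤ}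
    {s₃ : Fin m₃ → ℤ} {C : Matrix (Fin m₃) (Fin m₂) (PolyR k n)}
    (hC : C ∈ homogMat k n s₂ s₃) :
    (homogMat k n s₁ s₂).map (mulLeftLinearMap (Fin m₁) k C) =
      liftSpace s₁ ⊤ s₃ (LinearMap.range C.mulVecLin) := by
  ext X
  constructor
  · rintro ⟨Y, hY, rfl⟩
    exact ⟨mul_mem_homogMat hC hY, fun v _ => ⟨Y *ᵥ v, by simp [mulVec_mulVec]⟩⟩
  · intro hX
    obtain ⟨Y, hY, rfl⟩ := exists_eq_mul_of_mulVec_mem_range hC hX.1 fun v => hX.2 v trivial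
    exact ⟨Y, hY, rfl⟩

/-- The degree-preserving endomorphisms of the complex given by the matrix `C`. -/
def chainEnd {m₁ m₂ : ℕ} (s₁ : Fin m₁ → ℤ) (s₂ : Fin m₂ → ℤ)
    (C : Matrix (Fin m₂) (Fin m₁) (PolyR k n)) :
    Submodule k (Matrix (Fin m₁) (Fin m₁) (PolyR k n) × Matrix (Fin m₂) (Fin m₂) (PolyR k n)) :=
  (homogMat k n s₁ s₁).prod (homogMat k n s₂ s₂) ⊓
    LinearMap.eqLocus (mulRightLinearMap (Fin m₂) k C ∘ₗ LinearMap.snd k _ _)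
      (mulLeftLinearMap (Fin m₁) k C ∘ₗ LinearMap.fst k _ _)

theorem mem_chainEnd {m₁ m₂ : ℕ} {s₁ : Fin m₁ → ℤ} {s₂ : Fin m₂ → ℤ}
    {C : Matrix (Fin m₂) (Fin m₁) (PolyR k n)}
    {x : Matrix (Fin m₁) (Fin m₁) (PolyR k n) × Matrix (Fin m₂) (Fin m₂) (PolyR k n)} :
    x ∈ chainEnd s₁ s₂ C ↔
      (x.1 ∈ homogMat k n s₁ s₁ ∧ x.2 ∈ homogMat k n s₂ s₂) ∧ x.2 * C = C * x.1 := Iff.rfl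

instance finite_chainEnd {m₁ m₂ : ℕ} {s₁ : Fin m₁ → ℤ} {s₂ : Fin m₂ → ℤ}
    {C : Matrix (Fin m₂) (Fin m₁) (PolyR k n)} : Module.Finite k (chainEnd s₁ s₂ C) :=
  have : Module.Finite k ((homogMat k n s₁ s₁).prod (homogMat k n s₂ s₂)) :=
    Module.Finite.iff_fg.2
      ((Module.Finite.iff_fg.1 finite_homogMat).prod (Module.Finite.iff_fg.1 finite_homogMat))
  Submodule.finiteDimensional_of_le inf_le_left

theorem mul_left_cancel_of_mulVec_injective {S : Type} [CommRing S] {m₁ m₂ m₃ : ℕ}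
    {C : Matrix (Fin m₃) (Fin m₂) S} (hC : Function.Injective C.mulVec)
    {X Y : Matrix (Fin m₂) (Fin m₁) S} (h : C * X = C * Y) : X = Y :=
  mulVec_injective (funext fun v => hC (by rw [mulVec_mulVec, mulVec_mulVec, h]))

theorem finrank_liftSpace_coker (hA : A.transpose ∈ homogMat k n b a)
    (hinj : Function.Injective A.transpose.mulVec) :
    Module.finrank k (liftSpace a (LinearMap.range A.transpose.mulVecLin) a
        (LinearMap.range A.transpose.mulVecLin)) =
      Module.finrank k (chainEnd b a A.transpose) := by
  rw [← finrank_map_add_finrank_inf_ker (LinearMap.snd k _ _) (chainEnd b a A.transpose)]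
  have hker : chainEnd b a A.transpose ⊓ LinearMap.ker (LinearMap.snd k _ _) = ⊥ := by
    refine eq_bot_iff.2 ?_
    rintro ⟨α, β⟩ ⟨⟨_, h⟩, h0⟩
    obtain rfl : β = 0 := h0
    have : α = 0 := mul_left_cancel_of_mulVec_injective hinj
      ((mem_chainEnd.1 ⟨‹_›, h⟩).2.symm.trans (by simp))
    simp [this]
  have hmap : (chainEnd b a A.transpose).map (LinearMap.snd k _ _) =
      liftSpace a (LinearMap.range A.transpose.mulVecLin) a
        (LinearMap.range A.transpose.mulVecLin) := by
    ext X
    constructor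
    · rintro ⟨⟨α, β⟩, h, rfl⟩
      exact mem_liftSpace_of_mul_eq (mem_chainEnd.1 h).1.2 (mem_chainEnd.1 h).2
    · intro hX
      obtain ⟨Y, hY, h⟩ := exists_mul_eq_mul_of_mem_liftSpace hA hX
      exact ⟨⟨Y, X⟩, mem_chainEnd.2 ⟨⟨hY, hX.1⟩, h⟩, rfl⟩
  rw [hker, hmap, finrank_bot, add_zero]

theorem finrank_chainEnd_eq_add (hA : A.transpose ∈ homogMat k n b a) :
    Module.finrank k (liftSpace (-b) (LinearMap.range A.mulVecLin) (-b)
        (LinearMap.range A.mulVecLin)) +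
      Module.finrank k (liftSpace a (LinearMap.range A.transpose.mulVecLin) a ⊥) =
      Module.finrank k (chainEnd b a A.transpose) := by
  let f : Matrix (Fin p) (Fin p) (PolyR k n) × Matrix (Fin q) (Fin q) (PolyR k n) →ₗ[k]
      Matrix (Fin p) (Fin p) (PolyR k n) :=
    (transposeLinearEquiv (Fin p) (Fin p) k (PolyR k n)).toLinearMap ∘ₗ LinearMap.fst k _ _
  rw [← finrank_map_add_finrank_inf_ker f (chainEnd b a A.transpose)]
  have hker : chainEnd b a A.transpose ⊓ LinearMap.ker f =
      (liftSpace a (LinearMap.range A.transpose.mulVecLin) a ⊥).map (LinearMap.inr k _ _) := by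
    ext ⟨α, β⟩
    constructor
    · rintro ⟨h, h0⟩
      obtain rfl : α = 0 := transpose_eq_zero.1 h0
      obtain ⟨⟨_, hβ⟩, h⟩ := mem_chainEnd.1 h
      exact ⟨β, mem_liftSpace_range_bot.2 ⟨hβ, h.trans (Matrix.mul_zero _)⟩, rfl⟩
    · rintro ⟨β', h, h'⟩
      obtain ⟨rfl, rfl⟩ := Prod.ext_iff.1 h'
      obtain ⟨hβ, h⟩ := mem_liftSpace_range_bot.1 h
      exact ⟨mem_chainEnd.2 ⟨⟨zero_mem _, hβ⟩, h.trans (Matrix.mul_zero _).symm⟩,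
        transpose_zero⟩
  have hmap : (chainEnd b a A.transpose).map f =
      liftSpace (-b) (LinearMap.range A.mulVecLin) (-b) (LinearMap.range A.mulVecLin) := by
    ext X
    constructor
    · rintro ⟨⟨α, β⟩, h, rfl⟩
      obtain ⟨⟨hα, _⟩, h⟩ := mem_chainEnd.1 h
      refine mem_liftSpace_of_mul_eq (Y := β.transpose) (transpose_mem_homogMat.2 hα) ?_
      have : α.transpose * A = A * β.transpose := by
        simpa using (congrArg transpose h).symm
      exact this
    · intro hX
      obtain ⟨Y, hY, h⟩ :=
        exists_mul_eq_mul_of_mem_liftSpace (transpose_mem_homogMat.2 hA) hX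
      refine ⟨⟨X.transpose, Y.transpose⟩, mem_chainEnd.2 ⟨⟨?_, ?_⟩, ?_⟩, X.transpose_transpose⟩
      · exact transpose_mem_homogMat.1 hX.1
      · exact transpose_mem_homogMat.1 hY
      · simpa using (congrArg transpose h).symm
  rw [hker, hmap]
  exact congrArg (_ + ·) (Submodule.equivMapOfInjective _ LinearMap.inr_injective _).finrank_eq

theorem finrank_liftSpace_top_coker (hA : A.transpose ∈ homogMat k n b a)
    (hinj : Function.Injective A.transpose.mulVec) :
    Module.finrank k (liftSpace a ⊤ a (LinearMap.range A.transpose.mulVecLin)) =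
      Module.finrank k (homogMat k n a b) := by
  rw [← map_mulLeft_homogMat hA]
  exact (Submodule.equivMapOfInjective (mulLeftLinearMap (Fin q) k A.transpose)
    (fun _ _ h => mul_left_cancel_of_mulVec_injective hinj h) _).symm.finrank_eq

theorem finrank_liftSpace_top_add (hA : A.transpose ∈ homogMat k n b a) :
    Module.finrank k (liftSpace (-b) ⊤ (-b) (LinearMap.range A.mulVecLin)) +
      Module.finrank k (liftSpace a (LinearMap.range A.transpose.mulVecLin) b ⊥) =
      Module.finrank k (homogMat k n a b) := by
  let e := transposeLinearEquiv (Fin p) (Fin q) k (PolyR k n)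
  have he : (homogMat k n a b).map e.toLinearMap = homogMat k n (-b) (-a) := by
    ext X
    constructor
    · rintro ⟨Y, hY, rfl⟩
      exact transpose_mem_homogMat.2 hY
    · exact fun hX => ⟨X.transpose, transpose_mem_homogMat.1 hX, X.transpose_transpose⟩
  rw [← finrank_map_add_finrank_inf_ker
      (mulLeftLinearMap (Fin p) k A ∘ₗ e.toLinearMap) (homogMat k n a b),
    Submodule.map_comp, he, map_mulLeft_homogMat (C := A) (transpose_mem_homogMat.2 hA)]
  suffices liftSpace a (LinearMap.range A.transpose.mulVecLin) b ⊥ =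
      homogMat k n a b ⊓ LinearMap.ker (mulLeftLinearMap (Fin p) k A ∘ₗ e.toLinearMap) by
    rw [this]
  ext X
  rw [mem_liftSpace_range_bot, Submodule.mem_inf, LinearMap.mem_ker]
  refine and_congr_right fun _ => ?_
  rw [← transpose_eq_zero, transpose_mul, transpose_transpose]
  rfl

theorem zeroHomDim_coker_add (hA : IsHomogMat b a A)
    (hinj : Function.Injective A.transpose.mulVec) :
    zeroHomDim n a (LinearMap.range A.transpose.mulVecLin) a
        (LinearMap.range A.transpose.mulVecLin) +
      zeroHomDim n a (LinearMap.range A.transpose.mulVecLin) b ⊥ =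
    zeroHomDim n (-b) (LinearMap.range A.mulVecLin) (-b) (LinearMap.range A.mulVecLin) +
      zeroHomDim n a (LinearMap.range A.transpose.mulVecLin) a ⊥ := by
  have hT := hA.transpose_mem
  have hB := zeroHomDim_add_finrank (s₁ := a) (s₂ := a)
    (N₁ := LinearMap.range A.transpose.mulVecLin) (N₂ := LinearMap.range A.transpose.mulVecLin)
  have hM := zeroHomDim_add_finrank (s₁ := -b) (s₂ := -b)
    (N₁ := LinearMap.range A.mulVecLin) (N₂ := LinearMap.range A.mulVecLin)
  have h₁ := finrank_liftSpace_coker hT hinj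
  have h₂ := finrank_chainEnd_eq_add hT
  have h₃ := finrank_liftSpace_top_coker hT hinj
  have h₄ := finrank_liftSpace_top_add hT
  rw [zeroHomDim_bot, zeroHomDim_bot]
  omega

end Cokernels

end

noncomputable section

/-- Under the flag condition, for `2 ≤ i ≤ c`, counting `k`-dimensions of
degree-zero graded hom spaces one has
`_0hom(B_i,B_i) − _0hom(M_i,M_i) = _0hom(B_i,G_i) − _0hom(B_i,F)`; in particular, if
`_0hom(M_i,M_i) = 1` then `_0hom(B_i,B_i) = 1 + _0hom(B_i,G_i) − _0hom(B_i,F)`. -/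
theorem statement6 (k : Type) [Field k] (n t c : ℕ)
    (ht : 2 ≤ t) (hc : 2 ≤ c)
    (b : Fin t → ℤ) (a : Fin (t + c - 1) → ℤ) (hb : Monotone b) (ha : Monotone a)
    (A : Matrix (Fin t) (Fin (t + c - 1)) (PolyR k n))
    (hA : IsHomogMat b a A)
    (hflag : flagCond hc A)
    (i : ℕ) (h2 : 2 ≤ i) (hic : i ≤ c) :
    ((zeroHomDim n (fun j : Fin (t + i - 1) => a (Fin.castLE (by omega) j))
        (LinearMap.range (Matrix.mulVecLin (firstCols A (t + i - 1) (by omega)).transpose))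
        (fun j : Fin (t + i - 1) => a (Fin.castLE (by omega) j))
        (LinearMap.range (Matrix.mulVecLin (firstCols A (t + i - 1) (by omega)).transpose))
        : ℤ) -
      (zeroHomDim n (fun i' : Fin t => -(b i'))
        (LinearMap.range (Matrix.mulVecLin (firstCols A (t + i - 1) (by omega))))
        (fun i' : Fin t => -(b i'))
        (LinearMap.range (Matrix.mulVecLin (firstCols A (t + i - 1) (by omega)))) : ℤ) =
      (zeroHomDim n (fun j : Fin (t + i - 1) => a (Fin.castLE (by omega) j))
        (LinearMap.range (Matrix.mulVecLin (firstCols A (t + i - 1) (by omega)).transpose))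
        (fun j : Fin (t + i - 1) => a (Fin.castLE (by omega) j))
        (⊥ : Submodule (PolyR k n) (Fin (t + i - 1) → PolyR k n)) : ℤ) -
      (zeroHomDim n (fun j : Fin (t + i - 1) => a (Fin.castLE (by omega) j))
        (LinearMap.range (Matrix.mulVecLin (firstCols A (t + i - 1) (by omega)).transpose))
        b (⊥ : Submodule (PolyR k n) (Fin t → PolyR k n)) : ℤ)) ∧
    ((zeroHomDim n (fun i' : Fin t => -(b i'))
        (LinearMap.range (Matrix.mulVecLin (firstCols A (t + i - 1) (by omega))))
        (fun i' : Fin t => -(b i'))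
        (LinearMap.range (Matrix.mulVecLin (firstCols A (t + i - 1) (by omega)))) = 1) →
      (zeroHomDim n (fun j : Fin (t + i - 1) => a (Fin.castLE (by omega) j))
        (LinearMap.range (Matrix.mulVecLin (firstCols A (t + i - 1) (by omega)).transpose))
        (fun j : Fin (t + i - 1) => a (Fin.castLE (by omega) j))
        (LinearMap.range (Matrix.mulVecLin (firstCols A (t + i - 1) (by omega)).transpose))
        : ℤ) =
      1 +
      (zeroHomDim n (fun j : Fin (t + i - 1) => a (Fin.castLE (by omega) j))
        (LinearMap.range (Matrix.mulVecLin (firstCols A (t + i - 1) (by omega)).transpose))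
        (fun j : Fin (t + i - 1) => a (Fin.castLE (by omega) j))
        (⊥ : Submodule (PolyR k n) (Fin (t + i - 1) → PolyR k n)) : ℤ) -
      (zeroHomDim n (fun j : Fin (t + i - 1) => a (Fin.castLE (by omega) j))
        (LinearMap.range (Matrix.mulVecLin (firstCols A (t + i - 1) (by omega)).transpose))
        b (⊥ : Submodule (PolyR k n) (Fin t → PolyR k n)) : ℤ)) := by
  have hne : minorsIdeal t (firstCols A (t + i - 1) (by omega)) ≠ ⊥ := by
    intro h
    have := hflag i h2 hic
    rw [h, idealHeight_bot, eq_comm, Nat.cast_eq_zero] at this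
    omega
  have hA' : IsHomogMat b (fun j : Fin (t + i - 1) => a (Fin.castLE (by omega) j))
      (firstCols A (t + i - 1) (by omega)) := fun i' j => hA i' _
  have key := zeroHomDim_coker_add hA' (mulVec_transpose_injective_of_minorsIdeal_ne_bot hne)
  rw [show (-b) = fun i' => -(b i') from rfl] at key
  constructor
  · omega
  · intro h
    omega

end
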